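/- arXiv:quant-ph/0412031 — 2 statements merged into one kernel-verified Lean document; each statement's English description precedes it below -/
import Mathlib

section
/- Let H be a finite-dimensional complex inner product space, E an orthogonal projection on H, and C₁, …, C_m Hermitian operators with C_iE = C_i for all i. A family of operators D₁°, …, D_m° with D_i° ≥ 0 and Σ_{i=1}^m D_i° ≤ E attains the supremum of Σ_{i=1}^m Tr(C_iD_i) over all such families if and only if there exists a Hermitian operator B° with B° ≥ 0 and B° ≥ C_i for all i such that B°(E − D°) = 0, where D° = Σ_{i=1}^m D_i°, and (B° − C_i)D_i° = 0 for all i. In that case B° attains the infimum of Tr(BE) over all Hermitian B with B ≥ 0 and B ≥ C_i for all i, the same conditions are necessary and sufficient for dual optimality of B°, and the two optimal values coincide. -/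
open Matrix
open scoped ComplexOrder

section Helpers

open scoped MatrixOrder Matrix.Norms.L2Operator

lemma mad_psd_factor {n : ℕ} {A : Matrix (Fin n) (Fin n) ℂ} (hA : A.PosSemidef) :
    ∃ X : Matrix (Fin n) (Fin n) ℂ, A = Xᴴ * X := by
  obtain ⟨X, hX⟩ := CStarAlgebra.nonneg_iff_eq_star_mul_self.mp hA.nonneg
  exact ⟨X, hX⟩

lemma mad_trace_nonneg {n : ℕ} {A B : Matrix (Fin n) (Fin n) ℂ} (hA : A.PosSemidef)
    (hB : B.PosSemidef) : 0 ≤ ((A * B).trace).re ∧ (((A * B).trace).re = 0 → A * B = 0) := by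
  obtain ⟨X, rfl⟩ := mad_psd_factor hA
  obtain ⟨Y, rfl⟩ := mad_psd_factor hB
  have h : (Xᴴ * X * (Yᴴ * Y)).trace = ((X * Yᴴ) * (X * Yᴴ)ᴴ).trace := by
    rw [Matrix.conjTranspose_mul, Matrix.conjTranspose_conjTranspose, Matrix.trace_mul_comm,
      ← Matrix.mul_assoc, Matrix.trace_mul_comm]
    simp only [Matrix.mul_assoc]
  have h0 := (Matrix.posSemidef_self_mul_conjTranspose (X * Yᴴ)).trace_nonneg
  rw [h]
  obtain ⟨h1, h2⟩ := Complex.le_def.mp h0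
  refine ⟨by simpa using h1, fun h3 => ?_⟩
  have h4 : ((X * Yᴴ) * (X * Yᴴ)ᴴ).trace = 0 := by
    apply Complex.ext
    · simpa using h3
    · simpa using h2.symm
  rw [Matrix.trace_mul_conjTranspose_self_eq_zero_iff] at h4
  calc Xᴴ * X * (Yᴴ * Y) = Xᴴ * (X * Yᴴ) * Y := by simp only [Matrix.mul_assoc]
    _ = 0 := by rw [h4]; simp

lemma mad_mul_proj {n : ℕ} {E D : Matrix (Fin n) (Fin n) ℂ} (hE : E.IsHermitian)
    (hEE : E * E = E) (hD : D.PosSemidef) (hDE : (E - D).PosSemidef) : D * E = D := by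
  have hF : (1 - E).PosSemidef := by
    have h : 1 - E = (1 - E)ᴴ * (1 - E) := by
      rw [Matrix.conjTranspose_sub, hE.eq, Matrix.conjTranspose_one]
      simp [mul_sub, sub_mul, hEE]
    rw [h]
    exact Matrix.posSemidef_conjTranspose_mul_self _
  have h1 := mad_trace_nonneg hD hF
  have h2 := (mad_trace_nonneg hDE hF).1
  have h3 : (E - D) * (1 - E) = - (D * (1 - E)) := by
    simp [mul_sub, sub_mul, hEE]
  rw [h3, Matrix.trace_neg, Complex.neg_re] at h2
  have h4 := h1.2 (by linarith [h1.1])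
  rw [mul_sub, mul_one, sub_eq_zero] at h4
  exact h4.symm

lemma mad_small {a K s : ℝ} (hs : 0 ≤ s)
    (h : ∀ e : ℝ, 0 < e → e * s ≤ 2 → 2 * e * a + e ^ 2 * K ≤ 0) : a ≤ 0 := by
  by_contra! ha
  have hd : 0 < |K| + s + a + 1 := by positivity
  set e := min (a / (|K| + 1)) (1 / (s + 1)) with he
  have he0 : 0 < e := by positivity
  have h1 : e * (|K| + 1) ≤ a := by
    rw [← le_div_iff₀ (by positivity)]; exact min_le_left _ _
  have h2 : e * (s + 1) ≤ 1 := by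
    rw [← le_div_iff₀ (by positivity)]; exact min_le_right _ _
  have h3 := h e he0 (by nlinarith)
  have h4 : -|K| ≤ K := neg_abs_le K
  have h5 : 2 * a + e * K ≤ 0 := by
    by_contra! h6
    nlinarith [mul_pos he0 h6]
  nlinarith

lemma mad_key_ineq {n : ℕ} {ι : Type} [Fintype ι] [DecidableEq ι]
    (E : Matrix (Fin n) (Fin n) ℂ) (C D : ι → Matrix (Fin n) (Fin n) ℂ)
    (hD : ∀ i, (D i).PosSemidef) (hsum : ∑ i, D i = E)
    (hopt : ∀ D' : ι → Matrix (Fin n) (Fin n) ℂ, (∀ i, (D' i).PosSemidef) → ∑ i, D' i = E →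
      ∑ i, ((C i * D' i).trace).re ≤ ∑ i, ((C i * D i).trace).re)
    (Q : Matrix (Fin n) (Fin n) ℂ) (hQ : Q.PosSemidef) (hEQ : E * Q = Q) (hQE : Q * E = Q)
    (s : ℝ) (hs : 0 ≤ s) (hQQ : Q * Q = s • Q) (j : ι) :
    2 * ((C j * Q).trace).re ≤
      (((∑ i, C i * D i) * Q).trace).re + (((∑ i, D i * C i) * Q).trace).re := by
  have hterm : ∀ (e : ℝ) (i : ι), ((C i * ((1 - e • Q) * D i * (1 - e • Q))).trace).re =
      ((C i * D i).trace).re - e * (((C i * D i * Q).trace).re + ((D i * C i * Q).trace).re)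
        + e ^ 2 * ((C i * (Q * D i * Q)).trace).re := by
    intro e i
    have h1 : (D i * C i * Q).trace = (C i * (Q * D i)).trace := by
      rw [Matrix.mul_assoc, Matrix.trace_mul_comm, Matrix.mul_assoc]
    have h2 : C i * ((1 - e • Q) * D i * (1 - e • Q)) =
        C i * D i - e • (C i * D i * Q) - e • (C i * (Q * D i))
          + (e ^ 2) • (C i * (Q * D i * Q)) := by
      simp only [mul_sub, sub_mul, mul_one, one_mul, smul_mul_assoc, mul_smul_comm, smul_sub,
        smul_smul, Matrix.mul_assoc, pow_two]
      abel
    rw [h2, h1]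
    simp only [Matrix.trace_add, Matrix.trace_sub, Matrix.trace_smul, Complex.add_re,
      Complex.sub_re, Complex.smul_re, smul_eq_mul]
    ring
  have key : ∀ e : ℝ, 0 < e → e * s ≤ 2 →
      2 * e * (((C j * Q).trace).re - ((((∑ i, C i * D i) * Q).trace).re +
        (((∑ i, D i * C i) * Q).trace).re) / 2) + e ^ 2 *
        ((∑ i, ((C i * (Q * D i * Q)).trace).re) - s * ((C j * Q).trace).re) ≤ 0 := by
    intro e he hes
    have hh := hopt (fun i => (1 - e • Q) * D i * (1 - e • Q) +
      if i = j then (2 * e - e ^ 2 * s) • Q else 0) ?_ ?_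
    · simp only [mul_add, Matrix.trace_add, Complex.add_re, Finset.sum_add_distrib, hterm,
        Finset.sum_sub_distrib, ← Finset.mul_sum] at hh
      have h3 : ∑ i, ((C i * if i = j then (2 * e - e ^ 2 * s) • Q else 0).trace).re =
          (2 * e - e ^ 2 * s) * ((C j * Q).trace).re := by
        rw [Finset.sum_eq_single j]
        · rw [if_pos rfl, mul_smul_comm, Matrix.trace_smul, Complex.smul_re, smul_eq_mul]
        · intro b _ hb; simp [hb]
        · simp
      rw [h3] at hh
      simp only [Finset.sum_mul, Matrix.trace_sum, Complex.re_sum]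
      linarith
    · intro i
      refine Matrix.PosSemidef.add ?_ ?_
      · have h4 := (hD i).mul_mul_conjTranspose_same (1 - e • Q)
        have h5 : (1 - e • Q)ᴴ = 1 - e • Q := by
          simp [Matrix.conjTranspose_sub, Matrix.conjTranspose_smul, hQ.1.eq]
        rwa [h5] at h4
      · split_ifs
        · refine hQ.smul ?_
          nlinarith
        · exact Matrix.PosSemidef.zero
    · rw [Finset.sum_add_distrib, ← Finset.sum_mul, ← Finset.mul_sum, hsum]
      simp only [Finset.sum_ite_eq', Finset.mem_univ, if_true]
      simp only [mul_sub, sub_mul, mul_one, one_mul, smul_mul_assoc, mul_smul_comm, hEQ, hQE, hQQ,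
        smul_smul]
      module
  have := mad_small hs key
  linarith

lemma mad_dual {n : ℕ} {ι : Type} [Fintype ι] [DecidableEq ι]
    (E : Matrix (Fin n) (Fin n) ℂ) (C D : ι → Matrix (Fin n) (Fin n) ℂ)
    (hE : E.IsHermitian) (hEE : E * E = E)
    (hC : ∀ i, (C i).IsHermitian) (hCE : ∀ i, C i * E = C i)
    (hD : ∀ i, (D i).PosSemidef) (hsum : ∑ i, D i = E)
    (hopt : ∀ D' : ι → Matrix (Fin n) (Fin n) ℂ, (∀ i, (D' i).PosSemidef) → ∑ i, D' i = E →
      ∑ i, ((C i * D' i).trace).re ≤ ∑ i, ((C i * D i).trace).re) :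
    ∃ B : Matrix (Fin n) (Fin n) ℂ, (∀ i, (B - C i).PosSemidef) ∧
      ((B * E).trace).re = ∑ i, ((C i * D i).trace).re := by
  have hEC : ∀ i, E * C i = C i := by
    intro i
    have := congrArg Matrix.conjTranspose (hCE i)
    rwa [Matrix.conjTranspose_mul, hE.eq, (hC i).eq] at this
  have hDE : ∀ i, D i * E = D i := by
    intro i
    refine mad_mul_proj hE hEE (hD i) ?_
    rw [← hsum, ← Finset.add_sum_erase _ _ (Finset.mem_univ i), add_sub_cancel_left]
    exact Matrix.posSemidef_sum _ fun k _ => hD k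
  have hED : ∀ i, E * D i = D i := by
    intro i
    have := congrArg Matrix.conjTranspose (hDE i)
    rwa [Matrix.conjTranspose_mul, hE.eq, (hD i).1.eq] at this
  set G : Matrix (Fin n) (Fin n) ℂ := (1 / 2 : ℝ) • (∑ i, C i * D i + ∑ i, D i * C i) with hG
  have hGE : G * E = G := by
    simp only [hG, smul_mul_assoc, add_mul, Finset.sum_mul, Matrix.mul_assoc, hDE, hCE]
  have hEG : E * G = G := by
    simp only [hG, mul_smul_comm, mul_add, Finset.mul_sum, ← Matrix.mul_assoc, hED, hEC]
  have hGH : G.IsHermitian := by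
    unfold Matrix.IsHermitian
    simp only [hG, Matrix.conjTranspose_smul, Matrix.conjTranspose_add, Matrix.conjTranspose_sum,
      Matrix.conjTranspose_mul, (hC _).eq, (hD _).1.eq, star_trivial]
    rw [add_comm]
  refine ⟨G, fun j => ?_, ?_⟩
  · refine .of_dotProduct_mulVec_nonneg (hGH.sub (hC j)) fun x => ?_
    have hH : (G - C j).IsHermitian := hGH.sub (hC j)
    set y : Fin n → ℂ := E *ᵥ x with hy
    have hEy : E *ᵥ y = y := by rw [hy, Matrix.mulVec_mulVec, hEE]
    have hyE : star y ᵥ* E = star y := by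
      have := congrArg star hEy
      rwa [Matrix.star_mulVec, hE.eq] at this
    have hval : star x ⬝ᵥ (G - C j) *ᵥ x = star y ⬝ᵥ (G - C j) *ᵥ y := by
      have h1 : G - C j = E * (G - C j) * E := by
        simp only [mul_sub, sub_mul, hEG, hGE, hEC, hCE]
      conv_lhs => rw [h1]
      rw [← Matrix.mulVec_mulVec, ← Matrix.mulVec_mulVec, ← hy, Matrix.dotProduct_mulVec]
      congr 1
      rw [hy, Matrix.star_mulVec, hE.eq]
    have hs0 : (0 : ℂ) ≤ star y ⬝ᵥ y := dotProduct_star_self_nonneg y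
    obtain ⟨hs1, hs2⟩ := Complex.le_def.mp hs0
    have hs3 : star y ⬝ᵥ y = (((star y ⬝ᵥ y).re : ℝ) : ℂ) := by
      apply Complex.ext
      · simp
      · simpa using hs2.symm
    have hk := mad_key_ineq E C D hD hsum hopt (Matrix.vecMulVec y (star y))
      (Matrix.posSemidef_vecMulVec_self_star y)
      (by rw [Matrix.mul_vecMulVec, hEy]) (by rw [Matrix.vecMulVec_mul, hyE])
      ((star y ⬝ᵥ y).re) (by simpa using hs1)
      (by
        rw [Matrix.vecMulVec_mul_vecMulVec]
        conv_lhs => rw [hs3]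
        ext a b
        simp [Matrix.vecMulVec_apply]
        ring) j
    have htr : ∀ A : Matrix (Fin n) (Fin n) ℂ,
        (A * Matrix.vecMulVec y (star y)).trace = star y ⬝ᵥ A *ᵥ y := by
      intro A
      rw [Matrix.mul_vecMulVec, Matrix.trace_vecMulVec, dotProduct_comm]
    rw [hval, ← htr, Complex.le_def]
    constructor
    · have h2 : ((G * Matrix.vecMulVec y (star y)).trace).re = (1 / 2) *
          ((((∑ i, C i * D i) * Matrix.vecMulVec y (star y)).trace).re +
          (((∑ i, D i * C i) * Matrix.vecMulVec y (star y)).trace).re) := by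
        simp only [hG, smul_mul_assoc, add_mul, Matrix.trace_smul, Matrix.trace_add,
          Complex.smul_re, Complex.add_re, smul_eq_mul]
      rw [sub_mul, Matrix.trace_sub, Complex.sub_re, h2, Complex.zero_re]
      linarith
    · rw [htr]
      have := hH.im_star_dotProduct_mulVec_self y
      simpa using this.symm
  · rw [hGE, hG]
    simp only [Matrix.trace_smul, Matrix.trace_add, Matrix.trace_sum, Complex.smul_re,
      Complex.add_re, Complex.re_sum, smul_eq_mul, Matrix.trace_mul_comm (D _) (C _)]
    ring

lemma mad_exists {n : ℕ} {ι : Type} [Fintype ι] [DecidableEq ι] (i₀ : ι)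
    (E : Matrix (Fin n) (Fin n) ℂ) (C : ι → Matrix (Fin n) (Fin n) ℂ) (hE : E.PosSemidef) :
    ∃ D : ι → Matrix (Fin n) (Fin n) ℂ, (∀ i, (D i).PosSemidef) ∧ ∑ i, D i = E ∧
      ∀ D' : ι → Matrix (Fin n) (Fin n) ℂ, (∀ i, (D' i).PosSemidef) → ∑ i, D' i = E →
      ∑ i, ((C i * D' i).trace).re ≤ ∑ i, ((C i * D i).trace).re := by
  let S : Set (ι → Matrix (Fin n) (Fin n) ℂ) := {D | (∀ i, 0 ≤ D i) ∧ ∑ i, D i = E}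
  have : ProperSpace (Matrix (Fin n) (Fin n) ℂ) := FiniteDimensional.proper ℂ _
  have hS : IsCompact S := by
    refine (isCompact_univ_pi (fun _ : ι =>
      isCompact_closedBall (0 : Matrix (Fin n) (Fin n) ℂ) ‖E‖)).of_isClosed_subset ?_ ?_
    · refine IsClosed.inter (?_ : IsClosed {D : ι → Matrix (Fin n) (Fin n) ℂ | ∀ i, 0 ≤ D i})
        (?_ : IsClosed {D : ι → Matrix (Fin n) (Fin n) ℂ | ∑ i, D i = E})
      · rw [Set.ofPred_forall]
        refine isClosed_iInter fun i => ?_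
        have h0 : IsClosed {a : Matrix (Fin n) (Fin n) ℂ | 0 ≤ a} := CStarAlgebra.isClosed_nonneg
        exact h0.preimage (f := fun D : ι → Matrix (Fin n) (Fin n) ℂ => D i) (continuous_apply i)
      · exact isClosed_eq (by fun_prop) continuous_const
    · rintro D ⟨h1, h2⟩ i _
      rw [mem_closedBall_zero_iff]
      refine CStarAlgebra.norm_le_norm_of_nonneg_of_le (h1 i) ?_
      rw [← h2]
      exact Finset.single_le_sum (fun k _ => h1 k) (Finset.mem_univ i)
  have hne : S.Nonempty := by
    refine ⟨fun i => if i = i₀ then E else 0, fun i => ?_, by simp⟩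
    dsimp only
    split_ifs
    · exact hE.nonneg
    · exact le_rfl
  obtain ⟨D, hDS, hD⟩ := hS.exists_isMaxOn hne
    (f := fun D => ∑ i, ((C i * D i).trace).re) (by
      apply Continuous.continuousOn
      refine continuous_finsetSum _ fun i _ => Complex.continuous_re.comp ?_
      exact Continuous.matrix_trace (continuous_const.mul (continuous_apply i)))
  exact ⟨D, fun i => Matrix.nonneg_iff_posSemidef.mp (hDS.1 i), hDS.2,
    fun D' h1 h2 => hD ⟨fun i => (h1 i).nonneg, h2⟩⟩

end Helpers

lemma mad_weak {n m : ℕ} (E : Matrix (Fin n) (Fin n) ℂ) (C D : Fin m → Matrix (Fin n) (Fin n) ℂ)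
    (B : Matrix (Fin n) (Fin n) ℂ)
    (hD : ∀ i, (D i).PosSemidef) (hDE : (E - ∑ i, D i).PosSemidef)
    (hB : B.PosSemidef) (hBC : ∀ i, (B - C i).PosSemidef) :
    ∑ i, ((C i * D i).trace).re ≤ ((B * E).trace).re ∧
    (((B * E).trace).re = ∑ i, ((C i * D i).trace).re ↔
      (B * (E - ∑ i, D i) = 0 ∧ ∀ i, (B - C i) * D i = 0)) := by
  have h1 := mad_trace_nonneg hB hDE
  have h2 := fun i => mad_trace_nonneg (hBC i) (hD i)
  have h3 : ((B * E).trace).re - ∑ i, ((C i * D i).trace).re =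
      ((B * (E - ∑ i, D i)).trace).re + ∑ i, (((B - C i) * D i).trace).re := by
    simp only [mul_sub, sub_mul, Matrix.trace_sub, Complex.sub_re, Finset.sum_sub_distrib,
      Finset.mul_sum, Matrix.trace_sum, Complex.re_sum]
    ring
  have h4 : 0 ≤ ∑ i, (((B - C i) * D i).trace).re := Finset.sum_nonneg fun i _ => (h2 i).1
  refine ⟨by linarith [h1.1], fun h => ?_, fun h => ?_⟩
  · refine ⟨h1.2 (by linarith [h1.1]), fun i => (h2 i).2 ?_⟩
    have h5 : ∑ i, (((B - C i) * D i).trace).re = 0 := by linarith [h1.1]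
    exact (Finset.sum_eq_zero_iff_of_nonneg fun i _ => (h2 i).1).mp h5 i (Finset.mem_univ i)
  · simp only [h.1, h.2, Matrix.trace_zero, Complex.zero_re, Finset.sum_const_zero] at h3
    linarith

lemma mad_strong {n m : ℕ}
    (E : Matrix (Fin n) (Fin n) ℂ) (C D₀ : Fin m → Matrix (Fin n) (Fin n) ℂ)
    (hE : E.IsHermitian) (hEproj : E * E = E)
    (hC : ∀ i, (C i).IsHermitian) (hCE : ∀ i, C i * E = C i)
    (hD : ∀ i, (D₀ i).PosSemidef) (hDE : (E - ∑ i, D₀ i).PosSemidef)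
    (hopt : ∀ D : Fin m → Matrix (Fin n) (Fin n) ℂ,
          (∀ i, (D i).PosSemidef) → (E - ∑ i, D i).PosSemidef →
          ∑ i, ((C i * D i).trace).re ≤ ∑ i, ((C i * D₀ i).trace).re) :
    ∃ B : Matrix (Fin n) (Fin n) ℂ, B.PosSemidef ∧ (∀ i, (B - C i).PosSemidef) ∧
      ((B * E).trace).re = ∑ i, ((C i * D₀ i).trace).re := by
  obtain ⟨B, h1, h2⟩ := mad_dual (ι := Option (Fin m)) E (fun o => o.elim 0 C)
    (fun o => o.elim (E - ∑ i, D₀ i) D₀) hE hEproj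
    (by rintro (_ | i)
        · simp
        · exact hC i)
    (by rintro (_ | i)
        · simp
        · exact hCE i)
    (by rintro (_ | i)
        · exact hDE
        · exact hD i)
    (by simp [Fintype.sum_option])
    (by
      intro D' h1 h2
      rw [Fintype.sum_option] at h2
      simp only [Fintype.sum_option, Option.elim_none, Option.elim_some, zero_mul,
        Matrix.trace_zero, Complex.zero_re, zero_add]
      refine hopt (fun i => D' (some i)) (fun i => h1 _) ?_
      rw [← h2, add_sub_cancel_right]
      exact h1 _)
  refine ⟨B, by simpa using h1 none, fun i => h1 (some i), ?_⟩
  simpa [Fintype.sum_option] using h2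

lemma mad_primal {n m : ℕ}
    (E : Matrix (Fin n) (Fin n) ℂ) (C : Fin m → Matrix (Fin n) (Fin n) ℂ)
    (hE : E.PosSemidef) :
    ∃ D₀ : Fin m → Matrix (Fin n) (Fin n) ℂ,
      (∀ i, (D₀ i).PosSemidef) ∧ (E - ∑ i, D₀ i).PosSemidef ∧
      ∀ D : Fin m → Matrix (Fin n) (Fin n) ℂ,
          (∀ i, (D i).PosSemidef) → (E - ∑ i, D i).PosSemidef →
          ∑ i, ((C i * D i).trace).re ≤ ∑ i, ((C i * D₀ i).trace).re := by
  obtain ⟨D, h1, h2, h3⟩ := mad_exists (ι := Option (Fin m)) none E (fun o => o.elim 0 C) hE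
  rw [Fintype.sum_option] at h2
  refine ⟨fun i => D (some i), fun i => h1 _, ?_, fun D' h4 h5 => ?_⟩
  · rw [← h2, add_sub_cancel_right]
    exact h1 _
  · have := h3 (fun o => o.elim (E - ∑ i, D' i) D')
      (by rintro (_ | i)
          · exact h5
          · exact h4 i)
      (by simp [Fintype.sum_option])
    simpa [Fintype.sum_option] using this

/-- **Theorem 2.2.1** (optimality criterion for `m`-alternative detection).  A resolving
family `D₀ᵢ ≥ 0` with `∑ᵢ D₀ᵢ ≤ E` maximizes `∑ᵢ Tr (Cᵢ Dᵢ)` iff there is a Hermitian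
`B₀ ≥ 0, Cᵢ` with `B₀ (E − ∑ᵢ D₀ᵢ) = 0` and `(B₀ − Cᵢ) D₀ᵢ = 0` for all `i`; such `B₀`
solves the dual problem `inf {Tr (B E) : B ≥ 0, Cᵢ ∀i}`, the same conditions characterize
dual optimality, and the optimal values coincide. -/
theorem multialternative_detection_criterion {n m : ℕ}
    (E : Matrix (Fin n) (Fin n) ℂ) (C : Fin m → Matrix (Fin n) (Fin n) ℂ)
    (hE : E.IsHermitian) (hEproj : E * E = E)
    (hC : ∀ i, (C i).IsHermitian) (hCE : ∀ i, C i * E = C i) :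
    (∀ D₀ : Fin m → Matrix (Fin n) (Fin n) ℂ,
      (∀ i, (D₀ i).PosSemidef) → (E - ∑ i, D₀ i).PosSemidef →
      ((∀ D : Fin m → Matrix (Fin n) (Fin n) ℂ,
          (∀ i, (D i).PosSemidef) → (E - ∑ i, D i).PosSemidef →
          ∑ i, ((C i * D i).trace).re ≤ ∑ i, ((C i * D₀ i).trace).re) ↔
        (∃ B₀ : Matrix (Fin n) (Fin n) ℂ, B₀.PosSemidef ∧
          (∀ i, (B₀ - C i).PosSemidef) ∧
          B₀ * (E - ∑ i, D₀ i) = 0 ∧ ∀ i, (B₀ - C i) * D₀ i = 0))) ∧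
    (∀ (D₀ : Fin m → Matrix (Fin n) (Fin n) ℂ) (B₀ : Matrix (Fin n) (Fin n) ℂ),
      (∀ i, (D₀ i).PosSemidef) → (E - ∑ i, D₀ i).PosSemidef →
      B₀.PosSemidef → (∀ i, (B₀ - C i).PosSemidef) →
      B₀ * (E - ∑ i, D₀ i) = 0 → (∀ i, (B₀ - C i) * D₀ i = 0) →
      ∀ B : Matrix (Fin n) (Fin n) ℂ, B.PosSemidef → (∀ i, (B - C i).PosSemidef) →
        ((B₀ * E).trace).re ≤ ((B * E).trace).re) ∧
    (∀ B₀ : Matrix (Fin n) (Fin n) ℂ, B₀.PosSemidef → (∀ i, (B₀ - C i).PosSemidef) →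
      ((∀ B : Matrix (Fin n) (Fin n) ℂ, B.PosSemidef → (∀ i, (B - C i).PosSemidef) →
          ((B₀ * E).trace).re ≤ ((B * E).trace).re) ↔
        (∃ D₀ : Fin m → Matrix (Fin n) (Fin n) ℂ, (∀ i, (D₀ i).PosSemidef) ∧
          (E - ∑ i, D₀ i).PosSemidef ∧ B₀ * (E - ∑ i, D₀ i) = 0 ∧
          ∀ i, (B₀ - C i) * D₀ i = 0))) ∧
    sSup {t : ℝ | ∃ D : Fin m → Matrix (Fin n) (Fin n) ℂ,
        (∀ i, (D i).PosSemidef) ∧ (E - ∑ i, D i).PosSemidef ∧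
        t = ∑ i, ((C i * D i).trace).re} =
      sInf {t : ℝ | ∃ B : Matrix (Fin n) (Fin n) ℂ,
        B.PosSemidef ∧ (∀ i, (B - C i).PosSemidef) ∧ t = ((B * E).trace).re} := by
  have hEpsd : E.PosSemidef := by
    have h := Matrix.posSemidef_conjTranspose_mul_self E
    rwa [hE.eq, hEproj] at h
  obtain ⟨Ds, hDs1, hDs2, hDs3⟩ := mad_primal E C hEpsd
  obtain ⟨Bs, hBs1, hBs2, hBs3⟩ := mad_strong E C Ds hE hEproj hC hCE hDs1 hDs2 hDs3
  refine ⟨fun D₀ hD hDE => ⟨fun hopt => ?_, ?_⟩, ?_, fun B₀ hB hBC => ⟨fun hopt => ?_, ?_⟩, ?_⟩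
  · obtain ⟨B, h1, h2, h3⟩ := mad_strong E C D₀ hE hEproj hC hCE hD hDE hopt
    exact ⟨B, h1, h2, (mad_weak E C D₀ B hD hDE h1 h2).2.mp h3⟩
  · rintro ⟨B, h1, h2, h3⟩ D hD' hDE'
    rw [← (mad_weak E C D₀ B hD hDE h1 h2).2.mpr h3]
    exact (mad_weak E C D B hD' hDE' h1 h2).1
  · intro D₀ B₀ hD hDE hB hBC h1 h2 B hB' hBC'
    rw [(mad_weak E C D₀ B₀ hD hDE hB hBC).2.mpr ⟨h1, h2⟩]
    exact (mad_weak E C D₀ B hD hDE hB' hBC').1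
  · refine ⟨Ds, hDs1, hDs2, (mad_weak E C Ds B₀ hDs1 hDs2 hB hBC).2.mp (le_antisymm ?_ ?_)⟩
    · rw [← hBs3]
      exact hopt Bs hBs1 hBs2
    · exact (mad_weak E C Ds B₀ hDs1 hDs2 hB hBC).1
  · rintro ⟨D, hD, hDE, h⟩ B hB' hBC'
    rw [(mad_weak E C D B₀ hD hDE hB hBC).2.mpr h]
    exact (mad_weak E C D B hD hDE hB' hBC').1
  · refine Eq.trans (IsGreatest.csSup_eq (a := ∑ i, ((C i * Ds i).trace).re) ?_)
      (IsLeast.csInf_eq ?_).symm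
    · refine ⟨⟨Ds, hDs1, hDs2, rfl⟩, ?_⟩
      rintro t ⟨D, h1, h2, rfl⟩
      exact hDs3 D h1 h2
    · refine ⟨⟨Bs, hBs1, hBs2, hBs3.symm⟩, ?_⟩
      rintro t ⟨B, h1, h2, rfl⟩
      exact (mad_weak E C Ds B hDs1 hDs2 h1 h2).1
end

section
/- Let (α, ᾱ) ↦ S(α, ᾱ) be a family of positive semidefinite operators on a finite-dimensional complex inner product space H with Tr S = 1, depending on a complex parameter α and differentiable independently in α and ᾱ, and let ĥ be an operator solving the right logarithmic derivative equation Sĥ = ∂S/∂ᾱ (so that Tr(Sĥ) = 0 = Tr(Sĥ*)). If x̂ is any operator (not necessarily Hermitian or normal) with Tr(Sx̂) = θ(α, ᾱ), then ∂θ/∂α = Tr[S(x̂ − θ)ĥ*] and Tr[S(x̂ − θ)(x̂ − θ)*] ≥ |∂θ/∂α|² / Tr(Sĥĥ*). Consequently, since for any decomposition of unity I = Σ_j M_j into positive semidefinite operators with values x_j ∈ ℂ one has Σ_j |x_j − θ|²M_j ≥ (x̂ − θ)(x̂ − θ)* with x̂ = Σ_j x_jM_j, the variance R = Σ_j |x_j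 − θ|²Tr(SM_j) of any unbiased estimator satisfies R ≥ |∂θ/∂α|² / Tr(Sĥĥ*). -/
open Matrix
open scoped ComplexOrder

lemma rc_form_nonneg {n : ℕ} {S : Matrix (Fin n) (Fin n) ℂ} (hS : S.PosSemidef)
    (A : Matrix (Fin n) (Fin n) ℂ) : 0 ≤ (S * A * Aᴴ).trace := by
  rw [Matrix.trace_mul_comm, ← Matrix.mul_assoc]
  exact (hS.conjTranspose_mul_mul_same A).trace_nonneg

lemma rc_trace_mul_nonneg {n : ℕ} {S P : Matrix (Fin n) (Fin n) ℂ} (hS : S.PosSemidef)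
    (hP : P.PosSemidef) : 0 ≤ (S * P).trace := by
  obtain ⟨B, hB⟩ : ∃ B : Matrix (Fin n) (Fin n) ℂ, P = Bᴴ * B :=
    by
    open scoped MatrixOrder in
    exact CStarAlgebra.nonneg_iff_eq_star_mul_self.mp hP.nonneg
  have := rc_form_nonneg hS Bᴴ
  rwa [conjTranspose_conjTranspose, Matrix.mul_assoc, ← hB] at this

lemma rc_form_symm {n : ℕ} {S : Matrix (Fin n) (Fin n) ℂ} (hS : S.PosSemidef)
    (A B : Matrix (Fin n) (Fin n) ℂ) : (S * B * Aᴴ).trace = star (S * A * Bᴴ).trace := by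
  rw [← trace_conjTranspose, conjTranspose_mul, conjTranspose_mul, conjTranspose_conjTranspose,
    hS.1.eq, ← Matrix.mul_assoc, Matrix.trace_mul_comm (B * Aᴴ), Matrix.mul_assoc]

lemma rc_cs {n : ℕ} {S : Matrix (Fin n) (Fin n) ℂ} (hS : S.PosSemidef)
    (A h : Matrix (Fin n) (Fin n) ℂ) :
    ‖(S * A * hᴴ).trace‖ ^ 2 / ((S * h * hᴴ).trace).re ≤ ((S * A * Aᴴ).trace).re := by
  have hp := rc_form_nonneg hS A
  have hq := rc_form_nonneg hS h
  have hsym := rc_form_symm hS A h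
  have key : ∀ c : ℂ, 0 ≤ (S * (A - c • h) * (A - c • h)ᴴ).trace := fun c =>
    rc_form_nonneg hS _
  simp only [conjTranspose_sub, conjTranspose_smul, Matrix.mul_sub, Matrix.sub_mul, trace_sub,
    Matrix.mul_smul, Matrix.smul_mul, trace_smul, smul_eq_mul, hsym] at key
  generalize (S * A * hᴴ).trace = d at *
  generalize (S * A * Aᴴ).trace = p at *
  generalize (S * h * hᴴ).trace = q at *
  obtain ⟨hp1, hp2⟩ := Complex.nonneg_iff.mp hp
  obtain ⟨hq1, hq2⟩ := Complex.nonneg_iff.mp hq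
  rcases hq1.eq_or_lt with h0 | h0
  · rw [← h0]; simpa using hp1
  · have k := (Complex.nonneg_iff.mp (key (((q.re)⁻¹ : ℝ) * d))).1
    simp only [Complex.sub_re, Complex.mul_re, Complex.mul_im, Complex.star_def, Complex.conj_re,
      Complex.conj_im, Complex.ofReal_re, Complex.ofReal_im, map_mul, Complex.conj_ofReal,
      ← hq2, Complex.sub_im] at k
    rw [← Complex.normSq_eq_norm_sq, Complex.normSq_apply, div_eq_mul_inv]
    have hi : q.re * (q.re)⁻¹ = 1 := mul_inv_cancel₀ h0.ne'
    generalize (q.re)⁻¹ = r at *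
    have e : r * d.re * (r * d.re * q.re) = r * d.re * d.re := by
      linear_combination (r * d.re * d.re) * hi
    have e2 : r * d.im * (r * d.im * q.re) = r * d.im * d.im := by
      linear_combination (r * d.im * d.im) * hi
    ring_nf at k e e2 ⊢
    linarith

lemma rc_op_ineq {n k : ℕ} (M : Fin k → Matrix (Fin n) (Fin n) ℂ) (y : Fin k → ℂ)
    (hM : ∀ j, (M j).PosSemidef) (h1 : ∑ j, M j = 1) (A : Matrix (Fin n) (Fin n) ℂ)
    (hA : A = ∑ j, y j • M j) :
    (∑ j, ((‖y j‖ ^ 2 : ℝ) : ℂ) • M j - A * Aᴴ).PosSemidef := by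
  have hA' : Aᴴ = ∑ j, star (y j) • M j := by
    rw [hA, conjTranspose_sum]
    exact Finset.sum_congr rfl fun j _ => by rw [conjTranspose_smul, (hM j).1.eq]
  have : ∑ j, ((‖y j‖ ^ 2 : ℝ) : ℂ) • M j - A * Aᴴ
      = ∑ j, (y j • (1 : Matrix (Fin n) (Fin n) ℂ) - A) * M j * (y j • 1 - A)ᴴ := by
    have e : ∀ j, (y j • (1 : Matrix (Fin n) (Fin n) ℂ) - A) * M j * (y j • 1 - A)ᴴ
        = ((‖y j‖ ^ 2 : ℝ) : ℂ) • M j - (y j • M j) * Aᴴ - A * (star (y j) • M j)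
          + A * M j * Aᴴ := by
      intro j
      have : ((‖y j‖ ^ 2 : ℝ) : ℂ) = y j * star (y j) := by
        rw [Complex.star_def, Complex.mul_conj, Complex.normSq_eq_norm_sq]
      rw [this]
      simp only [conjTranspose_sub, conjTranspose_smul, conjTranspose_one, Matrix.mul_sub,
        Matrix.sub_mul, Matrix.mul_smul, Matrix.smul_mul, Matrix.one_mul, Matrix.mul_one, smul_smul]
      rw [mul_comm (y j), smul_sub, smul_smul]
      abel
    simp only [e, Finset.sum_add_distrib, Finset.sum_sub_distrib, ← Finset.sum_mul,
      ← Finset.mul_sum, h1]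
    rw [← hA, ← hA', Matrix.mul_one]
    abel
  rw [this]
  exact posSemidef_sum _ fun j _ => (hM j).mul_mul_conjTranspose_same _

lemma rc_deriv_herm {n : ℕ} (T : ℝ → Matrix (Fin n) (Fin n) ℂ) (D : Matrix (Fin n) (Fin n) ℂ)
    (hT : ∀ t, (T t).PosSemidef) (hd : ∀ i j, HasDerivAt (fun t => T t i j) (D i j) 0) :
    Dᴴ = D := by
  ext i j
  refine HasDerivAt.unique (f := fun t => T t i j) ?_ (hd i j)
  have := (hd j i).star
  convert this using 1
  · ext t
    exact ((hT t).1.apply i j).symm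
  · exact conjTranspose_apply _ _ _

lemma rc_deriv_trace {n : ℕ} (T : ℝ → Matrix (Fin n) (Fin n) ℂ) (D : Matrix (Fin n) (Fin n) ℂ)
    (hT : ∀ t, (T t).trace = 1) (hd : ∀ i j, HasDerivAt (fun t => T t i j) (D i j) 0) :
    D.trace = 0 := by
  have h1 : HasDerivAt (fun t => (T t).trace) D.trace 0 := by
    simpa [Matrix.trace] using HasDerivAt.fun_sum (u := Finset.univ) fun i _ => hd i i
  simp only [hT] at h1
  exact h1.unique (hasDerivAt_const _ _)

/-- Right (Belavkin–Yuen–Lax) noncommutative Rao–Cramér bound, scalar case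
(3.1.17)/(3.2.29).  `S` is a family of states depending on a complex parameter, with
Wirtinger partials at `α₀` encoded by `Sd1`, `Sd2` (derivatives in the real and imaginary
directions), `h` solves the right logarithmic derivative equation
`S h = ∂S/∂ᾱ = (Sd1 + i Sd2)/2`, `x` is any operator, and `θ α = Tr (S_α x)`.  Then
`Tr (S h) = 0 = Tr (S h*)`, `∂θ/∂α = Tr [S (x − θ) h*]`,
`Tr [S (x − θ)(x − θ)*] ≥ |∂θ/∂α|²/Tr (S h h*)`, and for any decomposition of unity
`∑ M_j = 1` with values `x_j` and `x = ∑ x_j M_j`, one has the operator inequality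
`∑ |x_j − θ|² M_j ≥ (x − θ)(x − θ)*` and hence
`R = ∑ |x_j − θ|² Tr (S M_j) ≥ |∂θ/∂α|²/Tr (S h h*)`. -/
theorem right_rao_cramer {n : ℕ}
    (S : ℂ → Matrix (Fin n) (Fin n) ℂ)
    (Sd1 Sd2 : Matrix (Fin n) (Fin n) ℂ) (α₀ : ℂ)
    (hS : ∀ α, (S α).PosSemidef) (htr : ∀ α, (S α).trace = 1)
    (hd1 : ∀ i j, HasDerivAt (fun t : ℝ => S (α₀ + (t : ℂ)) i j) (Sd1 i j) 0)
    (hd2 : ∀ i j, HasDerivAt (fun t : ℝ => S (α₀ + (t : ℂ) * Complex.I) i j) (Sd2 i j) 0)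
    (h : Matrix (Fin n) (Fin n) ℂ)
    (hRLD : S α₀ * h = (1 / 2 : ℂ) • (Sd1 + Complex.I • Sd2))
    (x : Matrix (Fin n) (Fin n) ℂ)
    (θ : ℂ → ℂ) (hθ : ∀ α, (S α * x).trace = θ α) :
    (S α₀ * h).trace = 0 ∧ (S α₀ * hᴴ).trace = 0 ∧
    (((1 / 2 : ℂ) • (Sd1 - Complex.I • Sd2) * x).trace =
      (S α₀ * (x - θ α₀ • 1) * hᴴ).trace) ∧
    (‖((1 / 2 : ℂ) • (Sd1 - Complex.I • Sd2) * x).trace‖ ^ 2 /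
        ((S α₀ * h * hᴴ).trace).re ≤
      ((S α₀ * (x - θ α₀ • 1) * (x - θ α₀ • 1)ᴴ).trace).re) ∧
    (∀ (k : ℕ) (M : Fin k → Matrix (Fin n) (Fin n) ℂ) (xs : Fin k → ℂ),
      (∀ j, (M j).PosSemidef) → ∑ j, M j = 1 → x = ∑ j, xs j • M j →
      ((∑ j, ((‖xs j - θ α₀‖ ^ 2 : ℝ) : ℂ) • M j -
          (x - θ α₀ • 1) * (x - θ α₀ • 1)ᴴ).PosSemidef ∧
        ‖((1 / 2 : ℂ) • (Sd1 - Complex.I • Sd2) * x).trace‖ ^ 2 /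
            ((S α₀ * h * hᴴ).trace).re ≤
          ∑ j, ‖xs j - θ α₀‖ ^ 2 * ((S α₀ * M j).trace).re)) := by
  have a1 := rc_deriv_herm (fun t : ℝ => S (α₀ + (t : ℂ))) Sd1 (fun _ => hS _) hd1
  have a2 := rc_deriv_herm (fun t : ℝ => S (α₀ + (t : ℂ) * Complex.I)) Sd2 (fun _ => hS _) hd2
  have b1 := rc_deriv_trace (fun t : ℝ => S (α₀ + (t : ℂ))) Sd1 (fun _ => htr _) hd1
  have b2 := rc_deriv_trace (fun t : ℝ => S (α₀ + (t : ℂ) * Complex.I)) Sd2 (fun _ => htr _) hd2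
  have c1 : (S α₀ * h).trace = 0 := by
    rw [hRLD]; simp [b1, b2]
  have c2 : (S α₀ * hᴴ).trace = 0 := by
    have := rc_form_symm (hS α₀) h 1
    simpa [c1] using this
  have hR' : hᴴ * S α₀ = (1 / 2 : ℂ) • (Sd1 - Complex.I • Sd2) := by
    have := congrArg conjTranspose hRLD
    rw [conjTranspose_mul, (hS α₀).1.eq] at this
    rw [this]
    simp [conjTranspose_smul, a1, a2, sub_eq_add_neg]
  have c3 : ((1 / 2 : ℂ) • (Sd1 - Complex.I • Sd2) * x).trace =
      (S α₀ * (x - θ α₀ • 1) * hᴴ).trace := by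
    rw [← hR', Matrix.mul_assoc, Matrix.trace_mul_comm]
    simp [Matrix.mul_sub, Matrix.sub_mul, c2]
  have c4 := rc_cs (hS α₀) (x - θ α₀ • 1) h
  rw [← c3] at c4
  refine ⟨c1, c2, c3, c4, ?_⟩
  intro k M xs hM h1 hx
  have hop := rc_op_ineq M (fun j => xs j - θ α₀) hM h1 (x - θ α₀ • 1) (by
    simp only [sub_smul, Finset.sum_sub_distrib, ← Finset.smul_sum, h1, ← hx])
  refine ⟨hop, c4.trans ?_⟩
  have := (Complex.nonneg_iff.mp (rc_trace_mul_nonneg (hS α₀) hop)).1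
  rw [Matrix.mul_sub, trace_sub, Complex.sub_re, ← Matrix.mul_assoc, Finset.mul_sum,
    trace_sum, Complex.re_sum] at this
  simp only [Matrix.mul_smul, trace_smul, smul_eq_mul, Complex.re_ofReal_mul] at this
  linarith
end
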